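/- arXiv:2006.00282 — 4 statements merged into one kernel-verified Lean document; each statement's English description precedes it below -/
import Mathlib

section
/- For a fixed constant Φ > 1, the map ρ ↦ (1/(1−ρ)) log(Φ/(Φ−1+ρ)) is strictly decreasing on [0,1). (Hence take-profit selling targets of this form are strictly decreasing functions of the risk aversion coefficient ρ.) -/
/-- For a fixed constant Φ > 1, the map ρ ↦ (1/(1−ρ)) log(Φ/(Φ−1+ρ)) is
strictly decreasing on [0,1). -/
theorem take_profit_target_strictAnti_in_rho
    (Φ : ℝ) (hΦ : 1 < Φ) :
    StrictAntiOn (fun ρ : ℝ => (1 / (1 - ρ)) * Real.log (Φ / (Φ - 1 + ρ)))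
      (Set.Ico (0 : ℝ) 1) := by
  -- The target is the slope of the secant of `log` between `Φ - 1 + ρ` and `Φ`.
  have target_eq_slope : ∀ ρ ∈ Set.Ico (0 : ℝ) 1,
      (1 / (1 - ρ)) * Real.log (Φ / (Φ - 1 + ρ)) =
        (Real.log (Φ - 1 + ρ) - Real.log Φ) / (Φ - 1 + ρ - Φ) := by
    rintro ρ ⟨h0, h1⟩
    rw [Real.log_div (by linarith) (by linarith), one_div_mul_eq_div, ← neg_div_neg_eq]
    congr 1 <;> ring
  intro x hx y hy hxy
  simp only [target_eq_slope x hx, target_eq_slope y hy]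
  obtain ⟨hx0, hx1⟩ := hx
  obtain ⟨hy0, hy1⟩ := hy
  exact strictConcaveOn_log_Ioi.secant_strict_mono
    (Set.mem_Ioi.2 (by linarith)) (Set.mem_Ioi.2 (by linarith)) (Set.mem_Ioi.2 (by linarith))
    (by linarith) (by linarith) (by linarith)
end

section
/- For ρ ∈ [0,1) and Φ > 1 − ρ, the function v̲ is continuously differentiable on ℝ and infinitely differentiable on ℝ ∖ {b̲}; in particular the smooth-fit identity Φ · U(e^{b̲}) = e^{(1−ρ) b̲} holds, equivalently U(e^{b̲}) = 1/(Φ−1+ρ). -/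
open Real

/-- CRRA utility evaluated at `e^x`: `U(e^x) = (e^{(1−ρ)x} − 1)/(1−ρ)`. -/
noncomputable def Ue (ρ x : ℝ) : ℝ := (Real.exp ((1 - ρ) * x) - 1) / (1 - ρ)

/-- The take-profit threshold `b̲ = (1/(1−ρ)) log(Φ/(Φ−1+ρ))`. -/
noncomputable def bLow (ρ Φ : ℝ) : ℝ := (1 / (1 - ρ)) * Real.log (Φ / (Φ - 1 + ρ))

/-- The value function `v̲(x) = e^{Φ(x−b̲)} U(e^{b̲})` for `x ≤ b̲`, and `U(e^x)` for `x > b̲`. -/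
noncomputable def vLow (ρ Φ x : ℝ) : ℝ :=
  if x ≤ bLow ρ Φ then Real.exp (Φ * (x - bLow ρ Φ)) * Ue ρ (bLow ρ Φ) else Ue ρ x

/-- Two differentiable functions agreeing to first order at `b` glue to a differentiable function. -/
theorem hasDerivAt_ite_le {f g f' g' : ℝ → ℝ} {b : ℝ}
    (hf : ∀ x, HasDerivAt f (f' x) x) (hg : ∀ x, HasDerivAt g (g' x) x)
    (hfg : f b = g b) (hfg' : f' b = g' b) (x : ℝ) :
    HasDerivAt (fun y => if y ≤ b then f y else g y) (if x ≤ b then f' x else g' x) x := by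
  rcases lt_trichotomy x b with hx | rfl | hx
  · rw [if_pos hx.le]
    refine (hf x).congr_of_eventuallyEq ?_
    filter_upwards [Iio_mem_nhds hx] with y hy
    exact if_pos (le_of_lt hy)
  · rw [if_pos le_rfl, ← hasDerivWithinAt_univ, ← Set.Iic_union_Ici (a := x)]
    refine HasDerivWithinAt.union ?_ ?_
    · exact (hf x).hasDerivWithinAt.congr (fun y hy => if_pos hy) (if_pos le_rfl)
    · rw [hfg']
      refine (hg x).hasDerivWithinAt.congr (fun y hy => ?_) (by simp [hfg])
      split_ifs with h
      · rw [le_antisymm h hy, hfg]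
      · rfl
  · rw [if_neg hx.not_ge]
    refine (hg x).congr_of_eventuallyEq ?_
    filter_upwards [Ioi_mem_nhds hx] with y hy
    exact if_neg (not_le_of_gt hy)

/-- Gluing two functions along a point is `C^1` if the functions agree to first order there. -/
theorem contDiff_one_ite_le {f g f' g' : ℝ → ℝ} {b : ℝ}
    (hf : ∀ x, HasDerivAt f (f' x) x) (hg : ∀ x, HasDerivAt g (g' x) x)
    (hf' : Continuous f') (hg' : Continuous g')
    (hfg : f b = g b) (hfg' : f' b = g' b) :
    ContDiff ℝ 1 (fun y => if y ≤ b then f y else g y) := by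
  have hd := hasDerivAt_ite_le hf hg hfg hfg'
  rw [contDiff_one_iff_deriv]
  refine ⟨fun x => (hd x).differentiableAt, ?_⟩
  rw [funext fun x => (hd x).deriv]
  exact hf'.if_le hg' continuous_id continuous_const fun x hx => by
    obtain rfl : x = b := hx
    exact hfg'

/-- Gluing two `C^n` functions at `b` is `C^n` away from `b`. -/
theorem contDiffOn_ite_le_compl {n : WithTop ℕ∞} {f g : ℝ → ℝ} {b : ℝ}
    (hf : ContDiff ℝ n f) (hg : ContDiff ℝ n g) :
    ContDiffOn ℝ n (fun y => if y ≤ b then f y else g y) {b}ᶜ := by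
  intro x hx
  refine ContDiffAt.contDiffWithinAt ?_
  rcases lt_or_gt_of_ne hx with hx | hx
  · refine hf.contDiffAt.congr_of_eventuallyEq ?_
    filter_upwards [Iio_mem_nhds hx] with y hy
    exact if_pos (le_of_lt hy)
  · refine hg.contDiffAt.congr_of_eventuallyEq ?_
    filter_upwards [Ioi_mem_nhds hx] with y hy
    exact if_neg (not_le_of_gt hy)

theorem hasDerivAt_Ue {ρ : ℝ} (hρ : ρ < 1) (x : ℝ) :
    HasDerivAt (Ue ρ) (Real.exp ((1 - ρ) * x)) x := by
  have h : 1 - ρ ≠ 0 := (sub_pos.2 hρ).ne'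
  have := ((((hasDerivAt_id x).const_mul (1 - ρ)).exp.sub_const 1).div_const (1 - ρ))
  refine this.congr_deriv ?_
  simp only [id]
  field_simp

theorem contDiff_Ue (ρ : ℝ) {n : WithTop ℕ∞} : ContDiff ℝ n (Ue ρ) := by
  unfold Ue
  fun_prop

theorem exp_mul_bLow {ρ Φ : ℝ} (hρ : ρ < 1) (hΦ : 1 - ρ < Φ) :
    Real.exp ((1 - ρ) * bLow ρ Φ) = Φ / (Φ - 1 + ρ) := by
  have h : 1 - ρ ≠ 0 := (sub_pos.2 hρ).ne'
  rw [bLow, ← mul_assoc, mul_one_div_cancel h, one_mul, Real.exp_log]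
  exact div_pos (by linarith) (by linarith)

theorem Ue_bLow {ρ Φ : ℝ} (hρ : ρ < 1) (hΦ : 1 - ρ < Φ) :
    Ue ρ (bLow ρ Φ) = 1 / (Φ - 1 + ρ) := by
  have h : 1 - ρ ≠ 0 := (sub_pos.2 hρ).ne'
  have h' : Φ - 1 + ρ ≠ 0 := by linarith
  rw [Ue, exp_mul_bLow hρ hΦ]
  field_simp
  ring

/-- For ρ ∈ [0,1) and Φ > 1 − ρ, the function v̲ is continuously
differentiable on ℝ and infinitely differentiable on ℝ ∖ {b̲}; in particular the
smooth-fit identity Φ·U(e^{b̲}) = e^{(1−ρ)b̲} holds, equivalently U(e^{b̲}) = 1/(Φ−1+ρ). -/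
theorem vLow_smoothness_and_smooth_fit
    (ρ Φ : ℝ) (hρ : ρ ∈ Set.Ico (0 : ℝ) 1) (hΦ : 1 - ρ < Φ) :
    ContDiff ℝ 1 (fun x => vLow ρ Φ x) ∧
    ContDiffOn ℝ (⊤ : ℕ∞) (fun x => vLow ρ Φ x) ({bLow ρ Φ}ᶜ) ∧
    Φ * Ue ρ (bLow ρ Φ) = Real.exp ((1 - ρ) * bLow ρ Φ) ∧
    Ue ρ (bLow ρ Φ) = 1 / (Φ - 1 + ρ) := by
  have hU := Ue_bLow hρ.2 hΦ
  have hfit : Φ * Ue ρ (bLow ρ Φ) = Real.exp ((1 - ρ) * bLow ρ Φ) := by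
    rw [hU, exp_mul_bLow hρ.2 hΦ, mul_one_div]
  refine ⟨?_, ?_, hfit, hU⟩
  · unfold vLow
    refine contDiff_one_ite_le
      (f' := fun x => Real.exp (Φ * (x - bLow ρ Φ)) * (Φ * Ue ρ (bLow ρ Φ)))
      (fun x => ?_) (hasDerivAt_Ue hρ.2) (by fun_prop) (by fun_prop) (by simp) (by simp [hfit])
    refine ((((hasDerivAt_id x).sub_const (bLow ρ Φ)).const_mul Φ).exp.mul_const
      (Ue ρ (bLow ρ Φ))).congr_deriv ?_
    simp only [id]
    ring
  · unfold vLow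
    exact contDiffOn_ite_le_compl (by fun_prop) (contDiff_Ue ρ)
end

section
/- For every x ≥ b̲ the function w ↦ v̲(x+w) − U(e^{x+w}) is Π-integrable on (−∞,0); the resulting function f(x) := ∫_{(−∞,0)} (v̲(x+w) − U(e^{x+w})) Π(dw) is continuous and nonincreasing on [b̲, ∞), and f(x) → 0 as x → ∞. -/
open MeasureTheory

/-- The jump-gap integral `f(x) = ∫_{(−∞,0)} (v̲(x+w) − U(e^{x+w})) ν(dw)`, where `ν` is
the Lévy measure (denoted Π in the paper). -/
noncomputable def fGap (ρ Φ : ℝ) (ν : Measure ℝ) (x : ℝ) : ℝ :=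
  ∫ w in Set.Iio (0 : ℝ), (vLow ρ Φ (x + w) - Ue ρ (x + w)) ∂ν

/-- The gap `v̲ − U(e^·)` below the threshold, as a function of `y = x − b̲ ≤ 0`. -/
noncomputable def expGap (a Φ y : ℝ) : ℝ :=
  (a * Real.exp (Φ * y) - Φ * Real.exp (a * y) + (Φ - a)) / (a * (Φ - a))

lemma expGap_zero (a Φ : ℝ) : expGap a Φ 0 = 0 := by
  simp [expGap]

lemma continuous_expGap (a Φ : ℝ) : Continuous (expGap a Φ) := by
  unfold expGap; fun_prop

lemma hasDerivAt_expGap {a Φ : ℝ} (ha : 0 < a) (hΦ : a < Φ) (y : ℝ) :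
    HasDerivAt (expGap a Φ)
      (Φ * (Real.exp (Φ * y) - Real.exp (a * y)) / (Φ - a)) y := by
  have hd (c : ℝ) : HasDerivAt (fun y => Real.exp (c * y)) (Real.exp (c * y) * c) y := by
    simpa using ((hasDerivAt_id y).const_mul c).exp
  have h := (((hd Φ).const_mul a).sub ((hd a).const_mul Φ)).add_const (Φ - a)
    |>.div_const (a * (Φ - a))
  have h' : Φ - a ≠ 0 := (sub_pos.2 hΦ).ne'
  refine h.congr_deriv ?_
  field_simp

lemma antitoneOn_expGap {a Φ : ℝ} (ha : 0 < a) (hΦ : a < Φ) :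
    AntitoneOn (expGap a Φ) (Set.Iic 0) := by
  refine antitoneOn_of_deriv_nonpos (convex_Iic 0) (continuous_expGap a Φ).continuousOn
    (fun y _ => (hasDerivAt_expGap ha hΦ y).differentiableAt.differentiableWithinAt) ?_
  intro y hy
  rw [interior_Iic, Set.mem_Iio] at hy
  rw [(hasDerivAt_expGap ha hΦ y).deriv]
  have h : Real.exp (Φ * y) ≤ Real.exp (a * y) := Real.exp_le_exp.2 (by nlinarith)
  exact div_nonpos_of_nonpos_of_nonneg
    (mul_nonpos_of_nonneg_of_nonpos (by linarith) (by linarith)) (by linarith)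

lemma expGap_nonneg {a Φ y : ℝ} (ha : 0 < a) (hΦ : a < Φ) (hy : y ≤ 0) :
    0 ≤ expGap a Φ y := by
  simpa [expGap_zero] using antitoneOn_expGap ha hΦ hy (Set.mem_Iic.2 le_rfl) hy

lemma expGap_le_inv {a Φ y : ℝ} (ha : 0 < a) (hΦ : a < Φ) (hy : y ≤ 0) :
    expGap a Φ y ≤ 1 / a := by
  have h : Real.exp (Φ * y) ≤ Real.exp (a * y) := Real.exp_le_exp.2 (by nlinarith)
  have hd : 0 < Φ - a := sub_pos.2 hΦ
  rw [expGap, div_le_div_iff₀ (by positivity) ha]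
  have := Real.exp_pos (a * y)
  have h1 : a * Real.exp (Φ * y) - Φ * Real.exp (a * y) ≤ 0 := by nlinarith
  nlinarith

lemma expGap_le_sq {a Φ y : ℝ} (ha : 0 < a) (hΦ : a < Φ) (hy : y ≤ 0) :
    expGap a Φ y ≤ Φ / 2 * y ^ 2 := by
  have hderiv (y : ℝ) : HasDerivAt (fun y => expGap a Φ y - Φ / 2 * y ^ 2)
      (Φ * (Real.exp (Φ * y) - Real.exp (a * y)) / (Φ - a) - Φ * y) y := by
    refine ((hasDerivAt_expGap ha hΦ y).sub ((hasDerivAt_pow 2 y).const_mul (Φ / 2))).congr_deriv ?_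
    norm_num
    ring
  have hmono : MonotoneOn (fun y => expGap a Φ y - Φ / 2 * y ^ 2) (Set.Iic 0) := by
    refine monotoneOn_of_deriv_nonneg (convex_Iic 0)
      (fun y _ => (hderiv y).continuousAt.continuousWithinAt)
      (fun y _ => (hderiv y).differentiableAt.differentiableWithinAt) ?_
    intro y hy
    rw [interior_Iic, Set.mem_Iio] at hy
    rw [(hderiv y).deriv, sub_nonneg, le_div_iff₀ (sub_pos.2 hΦ), mul_assoc]
    refine mul_le_mul_of_nonneg_left ?_ (by linarith)
    have hsplit : Real.exp (Φ * y) = Real.exp (a * y) * Real.exp ((Φ - a) * y) := by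
      rw [← Real.exp_add]; ring_nf
    have h1 := Real.add_one_le_exp ((Φ - a) * y)
    have h2 : Real.exp (a * y) ≤ 1 := Real.exp_le_one_iff.2 (by nlinarith)
    have h3 := Real.exp_pos (a * y)
    have h4 : (Φ - a) * y ≤ 0 := by nlinarith
    rw [hsplit]
    nlinarith
  simpa [expGap_zero] using hmono hy (Set.mem_Iic.2 le_rfl) hy

lemma expGap_le_min {a Φ y : ℝ} (ha : 0 < a) (hΦ : a < Φ) (hy : y ≤ 0) :
    expGap a Φ y ≤ (1 / a + Φ) * min 1 (y ^ 2) := by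
  have ha' : 0 < 1 / a := by positivity
  have hΦ' : 0 < Φ := ha.trans hΦ
  rcases min_cases 1 (y ^ 2) with ⟨h, -⟩ | ⟨h, -⟩ <;> rw [h]
  · linarith [expGap_le_inv ha hΦ hy]
  · nlinarith [expGap_le_sq ha hΦ hy, sq_nonneg y]

lemma vLow_sub_Ue {ρ Φ : ℝ} (hρ : ρ < 1) (hΦ : 1 - ρ < Φ) (z : ℝ) :
    vLow ρ Φ z - Ue ρ z = expGap (1 - ρ) Φ (min (z - bLow ρ Φ) 0) := by
  by_cases hz : z ≤ bLow ρ Φ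
  · have ha : 0 < 1 - ρ := sub_pos.2 hρ
    have hd : 0 < Φ - (1 - ρ) := sub_pos.2 hΦ
    have hb : Real.exp ((1 - ρ) * bLow ρ Φ) = Φ / (Φ - (1 - ρ)) := by
      have hd' : Φ - 1 + ρ = Φ - (1 - ρ) := by ring
      rw [bLow, ← mul_assoc, mul_one_div_cancel ha.ne', one_mul, hd',
        Real.exp_log (div_pos (ha.trans hΦ) hd)]
    have hsplit : Real.exp ((1 - ρ) * z) =
        Φ / (Φ - (1 - ρ)) * Real.exp ((1 - ρ) * (z - bLow ρ Φ)) := by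
      rw [← hb, ← Real.exp_add]; ring_nf
    rw [vLow, if_pos hz, min_eq_left (sub_nonpos.2 hz), Ue, Ue, hb, hsplit, expGap]
    generalize Real.exp (Φ * (z - bLow ρ Φ)) = E
    generalize Real.exp ((1 - ρ) * (z - bLow ρ Φ)) = F
    generalize 1 - ρ = a at *
    field_simp
    ring
  · rw [vLow, if_neg hz, min_eq_right (by linarith), expGap_zero, sub_self]


/-- For every x ≥ b̲ the function w ↦ v̲(x+w) − U(e^{x+w}) is Π-integrable
on (−∞,0); the resulting function f is continuous and nonincreasing on [b̲, ∞), and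
f(x) → 0 as x → ∞. -/
theorem fGap_integrable_continuous_antitone
    (ρ Φ : ℝ) (hρ : ρ ∈ Set.Ico (0 : ℝ) 1) (hΦ : 1 - ρ < Φ)
    (ν : Measure ℝ)
    (hν : IntegrableOn (fun w => min 1 (w ^ 2)) (Set.Iio (0 : ℝ)) ν) :
    (∀ x : ℝ, bLow ρ Φ ≤ x →
      IntegrableOn (fun w => vLow ρ Φ (x + w) - Ue ρ (x + w)) (Set.Iio (0 : ℝ)) ν) ∧
    ContinuousOn (fGap ρ Φ ν) (Set.Ici (bLow ρ Φ)) ∧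
    AntitoneOn (fGap ρ Φ ν) (Set.Ici (bLow ρ Φ)) ∧
    Filter.Tendsto (fGap ρ Φ ν) Filter.atTop (nhds 0) := by
  have ha : 0 < 1 - ρ := sub_pos.2 hρ.2
  set b := bLow ρ Φ
  set g : ℝ → ℝ := fun z => expGap (1 - ρ) Φ (min (z - b) 0)
  have hgap (z : ℝ) : vLow ρ Φ z - Ue ρ z = g z := vLow_sub_Ue hρ.2 hΦ z
  have hf : fGap ρ Φ ν = fun x => ∫ w in Set.Iio (0 : ℝ), g (x + w) ∂ν := by
    funext x; simp only [fGap, hgap]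
  simp only [hf, hgap]
  have hcont : Continuous g := (continuous_expGap _ _).comp (by fun_prop)
  have hanti : Antitone g := fun z₁ z₂ h => antitoneOn_expGap ha hΦ
    (Set.mem_Iic.2 (min_le_right _ _)) (Set.mem_Iic.2 (min_le_right _ _)) (min_le_min_right 0 (sub_le_sub_right h b))
  have hzero {z : ℝ} (hz : b ≤ z) : g z = 0 := by
    simp only [g, min_eq_right (sub_nonneg.2 hz), expGap_zero]
  have hmeas (x : ℝ) : AEStronglyMeasurable (fun w => g (x + w)) (ν.restrict (Set.Iio 0)) :=
    (hcont.comp (continuous_const_add x)).aestronglyMeasurable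
  have hbound (x : ℝ) (hx : b ≤ x) : ∀ᵐ w ∂ν.restrict (Set.Iio (0 : ℝ)),
      ‖g (x + w)‖ ≤ (1 / (1 - ρ) + Φ) * min 1 (w ^ 2) := by
    filter_upwards [ae_restrict_mem measurableSet_Iio] with w hw
    have hw : w ≤ 0 := le_of_lt hw
    rw [Real.norm_of_nonneg (expGap_nonneg ha hΦ (min_le_right _ _))]
    calc g (x + w) ≤ g (b + w) := hanti (by linarith)
      _ = expGap (1 - ρ) Φ w := by simp only [g, add_sub_cancel_left, min_eq_left hw]
      _ ≤ _ := expGap_le_min ha hΦ hw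
  have hdom : Integrable (fun w => (1 / (1 - ρ) + Φ) * min 1 (w ^ 2))
      (ν.restrict (Set.Iio 0)) := hν.const_mul _
  have hint (x : ℝ) (hx : b ≤ x) : IntegrableOn (fun w => g (x + w)) (Set.Iio 0) ν :=
    hdom.mono' (hmeas x) (hbound x hx)
  refine ⟨hint, ?_, ?_, ?_⟩
  · exact continuousOn_of_dominated (fun x _ => hmeas x) hbound hdom
      (.of_forall fun w => (hcont.comp (continuous_add_const w)).continuousOn)
  · exact fun x hx y hy hxy => integral_mono (hint y hy) (hint x hx)
      fun w => hanti (by linarith)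
  · have h := tendsto_integral_filter_of_dominated_convergence (f := fun _ => (0 : ℝ)) _
      (.of_forall hmeas) ((Filter.eventually_ge_atTop b).mono hbound) hdom
      (.of_forall fun w => tendsto_const_nhds.congr' <|
        (Filter.eventually_ge_atTop (b - w)).mono fun x hx => (hzero (by linarith)).symm)
    simpa using h
end

section
/- Generator identity above the threshold: for ρ ∈ [0,1), Φ > 1 − ρ, r > 0 and every x > b̲, the function w ↦ v̲(x+w) − U(e^x) − w·1_{(−1,0)}(w)·e^{(1−ρ)x} is Π-integrable on (−∞,0), and ½σ²(1−ρ)e^{(1−ρ)x} + μ e^{(1−ρ)x} + ∫_{(−∞,0)} ( v̲(x+w) − U(e^x) − w·1_{(−1,0)}(w)·e^{(1−ρ)x} ) Π(dw) − r·U(e^x) = χ(x), where χ(x) := r/(1−ρ) − ((r − ψ(1−ρ))/(1−ρ)) e^{(1−ρ)x} + f(x). -/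
open MeasureTheory

/-- The Laplace exponent of a spectrally negative Lévy process with triplet (μ, σ², ν):
`ψ(β) = μβ + ½σ²β² + ∫_{(−∞,0)} (e^{βw} − 1 − βw·1_{(−1,0)}(w)) ν(dw)`. -/
noncomputable def laplaceExponent (μ σ : ℝ) (ν : Measure ℝ) (β : ℝ) : ℝ :=
  μ * β + σ ^ 2 * β ^ 2 / 2 +
    ∫ w in Set.Iio (0 : ℝ),
      (Real.exp (β * w) - 1 - (if w ∈ Set.Ioo (-1 : ℝ) 0 then β * w else 0)) ∂ν

/-- `χ(x) = r/(1−ρ) − ((r − ψ(1−ρ))/(1−ρ)) e^{(1−ρ)x} + f(x)`. -/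
noncomputable def chiFn (ρ Φ μ σ r : ℝ) (ν : Measure ℝ) (x : ℝ) : ℝ :=
  r / (1 - ρ) - ((r - laplaceExponent μ σ ν (1 - ρ)) / (1 - ρ)) * Real.exp ((1 - ρ) * x) +
    fGap ρ Φ ν x

theorem measurable_Ue (ρ : ℝ) : Measurable (Ue ρ) := by
  unfold Ue
  fun_prop

theorem measurable_vLow (ρ Φ : ℝ) : Measurable (vLow ρ Φ) := by
  unfold vLow
  exact Measurable.ite measurableSet_Iic (by fun_prop) (measurable_Ue ρ)

/-- The compensated exponential is dominated by `min 1 w²` on the negative half-line. -/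
theorem abs_compensated_exp_le {c w : ℝ} (hc0 : 0 ≤ c) (hc1 : c ≤ 1) (hw : w < 0) :
    |Real.exp (c * w) - 1 - (if w ∈ Set.Ioo (-1 : ℝ) 0 then c * w else 0)| ≤ min 1 (w ^ 2) := by
  by_cases h : -1 < w
  · rw [if_pos ⟨h, hw⟩]
    have hcw : |c * w| ≤ |w| := by
      rw [abs_mul, abs_of_nonneg hc0]
      exact mul_le_of_le_one_left (abs_nonneg w) hc1
    have hw1 : |w| ≤ 1 := abs_le.2 ⟨h.le, by linarith⟩
    have hsq : (c * w) ^ 2 ≤ w ^ 2 := sq_le_sq.2 hcw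
    have hexp := (Real.abs_exp_sub_one_sub_id_le (hcw.trans hw1)).trans hsq
    exact le_min (hexp.trans ((sq_le_one_iff_abs_le_one w).2 hw1)) hexp
  · rw [if_neg fun hmem => h hmem.1, sub_zero]
    have hle : Real.exp (c * w) ≤ 1 :=
      Real.exp_le_one_iff.2 (mul_nonpos_of_nonneg_of_nonpos hc0 hw.le)
    have hpos := Real.exp_pos (c * w)
    have habs : |Real.exp (c * w) - 1| ≤ 1 := abs_le.2 ⟨by linarith, by linarith⟩
    exact le_min habs (habs.trans (by nlinarith))

theorem integrableOn_compensated_exp {c : ℝ} {ν : Measure ℝ} (hc0 : 0 ≤ c) (hc1 : c ≤ 1)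
    (hν : IntegrableOn (fun w => min 1 (w ^ 2)) (Set.Iio (0 : ℝ)) ν) :
    IntegrableOn
      (fun w => Real.exp (c * w) - 1 - (if w ∈ Set.Ioo (-1 : ℝ) 0 then c * w else 0))
      (Set.Iio (0 : ℝ)) ν := by
  refine Integrable.mono' hν (Measurable.aestronglyMeasurable ?_) ?_
  · exact Measurable.sub (by fun_prop)
      (Measurable.ite measurableSet_Ioo (by fun_prop) measurable_const)
  · filter_upwards [self_mem_ae_restrict measurableSet_Iio] with w hw
    exact abs_compensated_exp_le hc0 hc1 hw

/-- The gap between `vLow` and the utility is bounded. -/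
theorem abs_vLow_sub_Ue_le {ρ Φ : ℝ} (hρ : ρ < 1) (hΦ : 0 ≤ Φ) (y : ℝ) :
    |vLow ρ Φ y - Ue ρ y| ≤
      |Ue ρ (bLow ρ Φ)| + (Real.exp ((1 - ρ) * bLow ρ Φ) + 1) / (1 - ρ) := by
  have hc : 0 < 1 - ρ := sub_pos.2 hρ
  unfold vLow
  split_ifs with hy
  · refine (abs_sub _ _).trans (add_le_add ?_ ?_)
    · rw [abs_mul, Real.abs_exp]
      refine mul_le_of_le_one_left (abs_nonneg _) (Real.exp_le_one_iff.2 ?_)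
      exact mul_nonpos_of_nonneg_of_nonpos hΦ (sub_nonpos.2 hy)
    · unfold Ue
      rw [abs_div, abs_of_pos hc]
      have hexp : Real.exp ((1 - ρ) * y) ≤ Real.exp ((1 - ρ) * bLow ρ Φ) := by gcongr
      have hpos := Real.exp_pos ((1 - ρ) * y)
      gcongr
      exact abs_le.2 ⟨by linarith, by linarith⟩
  · rw [sub_self, abs_zero]
    positivity

/-- Above the threshold the gap vanishes for small jumps, hence is integrable against `ν`. -/
theorem integrableOn_vLow_sub_Ue {ρ Φ x : ℝ} {ν : Measure ℝ} (hρ : ρ < 1) (hΦ : 0 ≤ Φ)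
    (hx : bLow ρ Φ < x)
    (hν : IntegrableOn (fun w => min 1 (w ^ 2)) (Set.Iio (0 : ℝ)) ν) :
    IntegrableOn (fun w => vLow ρ Φ (x + w) - Ue ρ (x + w)) (Set.Iio (0 : ℝ)) ν := by
  obtain ⟨K, hK⟩ : ∃ K, ∀ y, |vLow ρ Φ y - Ue ρ y| ≤ K := ⟨_, abs_vLow_sub_Ue_le hρ hΦ⟩
  have hK0 : 0 ≤ K := (abs_nonneg _).trans (hK 0)
  set m : ℝ := min 1 ((x - bLow ρ Φ) ^ 2)
  have hm0 : 0 < m := lt_min one_pos (pow_pos (sub_pos.2 hx) 2)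
  refine Integrable.mono' (hν.const_mul (K / m)) (Measurable.aestronglyMeasurable ?_)
    (Filter.Eventually.of_forall fun w => ?_)
  · have hshift : Measurable fun w : ℝ => x + w := by fun_prop
    exact ((measurable_vLow ρ Φ).comp hshift).sub ((measurable_Ue ρ).comp hshift)
  · rw [Real.norm_eq_abs]
    by_cases hw : x + w ≤ bLow ρ Φ
    · have hmin : m ≤ min 1 (w ^ 2) := min_le_min le_rfl (by nlinarith)
      calc |vLow ρ Φ (x + w) - Ue ρ (x + w)| ≤ K := hK _
        _ = K / m * m := (div_mul_cancel₀ K hm0.ne').symm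
        _ ≤ K / m * min 1 (w ^ 2) := by gcongr
    · rw [vLow, if_neg hw, sub_self, abs_zero]
      positivity

/-- The generator integrand is the gap plus a multiple of the compensated exponential. -/
theorem generator_integrand_eq {ρ : ℝ} (hρ : ρ < 1) (Φ x w : ℝ) :
    vLow ρ Φ (x + w) - Ue ρ x -
        (if w ∈ Set.Ioo (-1 : ℝ) 0 then w * Real.exp ((1 - ρ) * x) else 0) =
      (vLow ρ Φ (x + w) - Ue ρ (x + w)) + Real.exp ((1 - ρ) * x) / (1 - ρ) *
        (Real.exp ((1 - ρ) * w) - 1 -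
          (if w ∈ Set.Ioo (-1 : ℝ) 0 then (1 - ρ) * w else 0)) := by
  have hc : 1 - ρ ≠ 0 := (sub_pos.2 hρ).ne'
  unfold Ue
  rw [mul_add, Real.exp_add]
  split_ifs <;> field_simp <;> ring

/-- Generator identity above the threshold: for ρ ∈ [0,1), Φ > 1 − ρ, r > 0
and every x > b̲, the function w ↦ v̲(x+w) − U(e^x) − w·1_{(−1,0)}(w)·e^{(1−ρ)x} is
Π-integrable on (−∞,0), and
½σ²(1−ρ)e^{(1−ρ)x} + μ e^{(1−ρ)x}
  + ∫_{(−∞,0)} ( v̲(x+w) − U(e^x) − w·1_{(−1,0)}(w)·e^{(1−ρ)x} ) Π(dw) − r·U(e^x) = χ(x). -/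
theorem generator_identity_above_threshold
    (ρ Φ μ σ r : ℝ) (hρ : ρ ∈ Set.Ico (0 : ℝ) 1) (hΦ : 1 - ρ < Φ)
    (hσ : 0 ≤ σ) (hr : 0 < r)
    (ν : Measure ℝ)
    (hν : IntegrableOn (fun w => min 1 (w ^ 2)) (Set.Iio (0 : ℝ)) ν) :
    ∀ x : ℝ, bLow ρ Φ < x →
      IntegrableOn
        (fun w => vLow ρ Φ (x + w) - Ue ρ x -
          (if w ∈ Set.Ioo (-1 : ℝ) 0 then w * Real.exp ((1 - ρ) * x) else 0))
        (Set.Iio (0 : ℝ)) ν ∧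
      σ ^ 2 / 2 * (1 - ρ) * Real.exp ((1 - ρ) * x) + μ * Real.exp ((1 - ρ) * x) +
          (∫ w in Set.Iio (0 : ℝ),
            (vLow ρ Φ (x + w) - Ue ρ x -
              (if w ∈ Set.Ioo (-1 : ℝ) 0 then w * Real.exp ((1 - ρ) * x) else 0)) ∂ν) -
          r * Ue ρ x =
        chiFn ρ Φ μ σ r ν x := by
  intro x hx
  have hc : 1 - ρ ≠ 0 := (sub_pos.2 hρ.2).ne'
  have hgap := integrableOn_vLow_sub_Ue hρ.2 (by linarith [hρ.2]) hx hν
  have hexp := (integrableOn_compensated_exp (c := 1 - ρ) (by linarith [hρ.2])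
    (by linarith [hρ.1]) hν).const_mul (Real.exp ((1 - ρ) * x) / (1 - ρ))
  simp_rw [generator_integrand_eq hρ.2]
  refine ⟨hgap.add hexp, ?_⟩
  rw [integral_add hgap hexp, integral_const_mul]
  unfold chiFn laplaceExponent fGap
  rw [show Ue ρ x = (Real.exp ((1 - ρ) * x) - 1) / (1 - ρ) from rfl]
  field_simp
  ring
end
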